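/- arXiv:2411.01556 — 2 statements merged into one kernel-verified Lean document; each statement's English description precedes it below -/
import Mathlib

section
/- If a topological dynamical system (X,T) has the specification property, then (X,T) has the vague specification property. -/
open Filter Topology

/-- A set of natural numbers has asymptotic density one. -/
def DensityOne (A : Set ℕ) : Prop :=
  atTop.liminf (fun n : ℕ => (Nat.card {i : ℕ // i < n ∧ i ∈ A} : ℝ) / n) = 1

/-- Vague pseudo-orbit: for every open set `U` in the product space containing the set of
orbits `Γ_T`, the set of times `n` whose shifted sequence lies in `U` has density one. -/
def IsVaguePO {X : Type*} [MetricSpace X] (T : X → X) (x : ℕ → X) : Prop :=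
  ∀ U : Set (ℕ → X), IsOpen U →
    {y : ℕ → X | ∃ p : X, y = fun n => T^[n] p} ⊆ U →
    DensityOne {n : ℕ | (fun k => x (k + n)) ∈ U}

/-- Vague specification property. -/
def VagueSpec {X : Type*} [MetricSpace X] (T : X → X) : Prop :=
  ∀ x : ℕ → X, IsVaguePO T x →
    ∃ z : X, ∀ ε : ℝ, 0 < ε → DensityOne {n : ℕ | dist (T^[n] z) (x n) < ε}

/-- The specification property of Bowen. -/
def SpecProp {X : Type*} [MetricSpace X] (T : X → X) : Prop :=
  ∀ ε : ℝ, 0 < ε → ∃ N : ℕ, 0 < N ∧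
    ∀ k : ℕ, 0 < k → ∀ x : ℕ → X, ∀ a b : ℕ → ℕ,
      a 0 = 0 →
      (∀ j : ℕ, j < k → a j ≤ b j) →
      (∀ j : ℕ, j + 1 < k → b j < a (j + 1)) →
      (∀ j : ℕ, j + 1 < k → N ≤ a (j + 1) - b j) →
      ∃ z : X, ∀ j : ℕ, j < k → ∀ n : ℕ, a j ≤ n → n ≤ b j →
        dist (T^[n] z) (T^[n - a j] (x j)) < ε

open Classical in
/-- number of elements of `B` below `n` -/
noncomputable def cntBelow (B : Set ℕ) (n : ℕ) : ℕ := ((Finset.range n).filter (· ∈ B)).card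

lemma natCard_eq (A : Set ℕ) (n : ℕ) :
    Nat.card {i : ℕ // i < n ∧ i ∈ A} = cntBelow A n := by
  classical
  unfold cntBelow
  rw [Nat.subtype_card]
  intro i
  simp

lemma cnt_add (A : Set ℕ) (n : ℕ) : cntBelow A n + cntBelow Aᶜ n = n := by
  classical
  unfold cntBelow
  have := Finset.card_filter_add_card_filter_not (s := Finset.range n) (fun i => i ∈ A)
  simpa using this

lemma densityOne_of (A : Set ℕ)
    (h : ∀ δ : ℝ, 0 < δ → ∃ M : ℕ, ∀ n ≥ M, (cntBelow Aᶜ n : ℝ) ≤ δ * n) : DensityOne A := by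
  unfold DensityOne
  apply Tendsto.liminf_eq
  rw [Metric.tendsto_atTop]
  intro ε hε
  obtain ⟨M, hM⟩ := h (ε / 2) (by positivity)
  refine ⟨M + 1, fun n hn => ?_⟩
  have hn0 : (0 : ℝ) < n := by exact_mod_cast (by omega : 0 < n)
  have h1 := hM n (by omega)
  have h2 : (cntBelow A n : ℝ) + cntBelow Aᶜ n = n := by exact_mod_cast cnt_add A n
  have h3 : (0 : ℝ) ≤ cntBelow Aᶜ n := by positivity
  rw [natCard_eq, Real.dist_eq]
  have h4 : (cntBelow A n : ℝ) / n - 1 = - (cntBelow Aᶜ n / n) := by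
    field_simp; linarith
  rw [h4, abs_neg, abs_of_nonneg (by positivity), div_lt_iff₀ hn0]
  nlinarith

lemma of_densityOne (A : Set ℕ) (h : DensityOne A) (δ : ℝ) (hδ : 0 < δ) :
    ∃ M : ℕ, ∀ n ≥ M, (cntBelow Aᶜ n : ℝ) ≤ δ * n := by
  unfold DensityOne at h
  have hb : IsBoundedUnder (· ≥ ·) atTop
      (fun n : ℕ => (Nat.card {i : ℕ // i < n ∧ i ∈ A} : ℝ) / n) :=
    isBoundedUnder_of ⟨0, fun n => by positivity⟩
  have h1 := eventually_lt_of_lt_liminf (b := 1 - δ) (by rw [h]; linarith) hb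
  obtain ⟨M, hM⟩ := eventually_atTop.1 h1
  refine ⟨M + 1, fun n hn => ?_⟩
  have hn0 : (0 : ℝ) < n := by exact_mod_cast (by omega : 0 < n)
  have h2 := hM n (by omega)
  rw [natCard_eq, lt_div_iff₀ hn0] at h2
  have h3 : (cntBelow A n : ℝ) + cntBelow Aᶜ n = n := by exact_mod_cast cnt_add A n
  nlinarith

lemma cnt_mod (L N n : ℕ) : cntBelow {i | i % L < N} n ≤ (n / L + 1) * N := by
  classical
  unfold cntBelow
  calc _ ≤ (((Finset.range (n / L + 1)) ×ˢ (Finset.range N)).image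
          (fun q : ℕ × ℕ => L * q.1 + q.2)).card := by
        apply Finset.card_le_card
        intro i hi
        simp only [Finset.mem_filter, Finset.mem_range, Set.mem_ofPred_eq] at hi
        rw [Finset.mem_image]
        refine ⟨(i / L, i % L), ?_, Nat.div_add_mod i L⟩
        simp only [Finset.mem_product, Finset.mem_range]
        exact ⟨Nat.lt_succ_of_le (Nat.div_le_div_right hi.1.le), hi.2⟩
    _ ≤ _ := by
        refine Finset.card_image_le.trans ?_
        simp

lemma cnt_blk (L n : ℕ) (hL : 0 < L) (B : Set ℕ) :
    cntBelow {i | i / L * L ∈ B} n ≤ cntBelow B n * L := by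
  classical
  unfold cntBelow
  calc _ ≤ ((((Finset.range n).filter (· ∈ B)) ×ˢ (Finset.range L)).image
          (fun q : ℕ × ℕ => q.1 + q.2)).card := by
        apply Finset.card_le_card
        intro i hi
        simp only [Finset.mem_filter, Finset.mem_range, Set.mem_ofPred_eq] at hi
        rw [Finset.mem_image]
        refine ⟨(i / L * L, i % L), ?_, Nat.div_add_mod' i L⟩
        simp only [Finset.mem_product, Finset.mem_range, Finset.mem_filter]
        exact ⟨⟨(Nat.div_mul_le_self i L).trans_lt hi.1, hi.2⟩, Nat.mod_lt _ hL⟩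
    _ ≤ _ := by
        refine Finset.card_image_le.trans ?_
        simp

lemma cnt_union (A B : Set ℕ) (n : ℕ) :
    cntBelow (A ∪ B) n ≤ cntBelow A n + cntBelow B n := by
  classical
  unfold cntBelow
  refine le_trans (Finset.card_le_card ?_) (Finset.card_union_le _ _)
  intro i
  simp only [Finset.mem_filter, Finset.mem_union, Set.mem_union]
  tauto

lemma cnt_mono (A B : Set ℕ) (n : ℕ) (h : ∀ i < n, i ∈ A → i ∈ B) :
    cntBelow A n ≤ cntBelow B n := by
  classical
  unfold cntBelow
  apply Finset.card_le_card
  intro i hi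
  simp only [Finset.mem_filter, Finset.mem_range] at hi ⊢
  exact ⟨hi.1, h i hi.1 hi.2⟩

lemma cnt_lt (m n : ℕ) : cntBelow {i | i < m} n ≤ m := by
  classical
  unfold cntBelow
  calc _ ≤ (Finset.range m).card := by
        apply Finset.card_le_card
        intro i hi
        simp only [Finset.mem_filter, Set.mem_ofPred_eq] at hi
        simpa using hi.2
    _ = m := by simp

lemma step_lemma {X : Type*} [MetricSpace X] (T : X → X) (hspec : SpecProp T)
    (x : ℕ → X) (hx : IsVaguePO T x) (ε δ : ℝ) (hε : 0 < ε) (hδ : 0 < δ) :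
    ∃ (P : Set ℕ) (L M0 : ℕ), 0 < L ∧ (∀ n ≥ M0, (cntBelow P n : ℝ) ≤ δ * n) ∧
      ∀ (w : X) (q M : ℕ), ∃ w' : X,
        (∀ n < L * q, dist (T^[n] w') (T^[n] w) < ε) ∧
        ∀ n, L * q ≤ n → n < M → n ∉ P → dist (T^[n] w') (x n) < 2 * ε := by
  obtain ⟨N, hN, hS⟩ := hspec ε hε
  obtain ⟨c, hc⟩ := exists_nat_gt (3 / δ)
  set L := N * (c + 1) + 1 with hLdef
  have hNL : N < L := by rw [hLdef]; nlinarith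
  have hL : 0 < L := by omega
  let U : Set (ℕ → X) := {y | ∃ p : X, ∀ i < L, dist (y i) (T^[i] p) < ε}
  have hU : IsOpen U := by
    have : U = ⋃ p : X, ⋂ i ∈ Finset.range L, {y : ℕ → X | dist (y i) (T^[i] p) < ε} := by
      ext y; simp [U]
    rw [this]
    refine isOpen_iUnion fun p => isOpen_biInter_finset fun i _ => ?_
    exact isOpen_lt (by fun_prop) continuous_const
  have hD := hx U hU (by
    rintro y ⟨p, rfl⟩
    exact ⟨p, fun i _ => by simpa using hε⟩)
  set G := {n : ℕ | (fun k => x (k + n)) ∈ U} with hG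
  have hL0 : (0 : ℝ) < L := by exact_mod_cast hL
  obtain ⟨M1, hM1⟩ := of_densityOne G hD (δ / (3 * L)) (by positivity)
  obtain ⟨M2, hM2⟩ := exists_nat_gt (3 * N / δ)
  refine ⟨{i | i % L < N} ∪ {i | i / L * L ∈ Gᶜ}, L, M1 + M2, hL, ?_, ?_⟩
  · intro n hn
    have e1 : (cntBelow ({i | i % L < N} ∪ {i | i / L * L ∈ Gᶜ}) n : ℝ)
        ≤ ((n / L : ℕ) + 1) * N + cntBelow Gᶜ n * L := by
      exact_mod_cast (cnt_union _ _ n).trans (add_le_add (cnt_mod L N n) (cnt_blk L n hL _))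
    have e2 : ((n / L : ℕ) : ℝ) ≤ n / L := Nat.cast_div_le
    have e3 : (cntBelow Gᶜ n : ℝ) * L ≤ δ / 3 * n := by
      have := mul_le_mul_of_nonneg_right (hM1 n (by omega)) hL0.le
      refine this.trans (le_of_eq ?_)
      field_simp
    have e4 : (N : ℝ) ≤ δ / 3 * n := by
      have h1 : (M2 : ℝ) ≤ n := by exact_mod_cast (by omega : M2 ≤ n)
      have h2 := hM2.trans_le h1
      rw [div_lt_iff₀ hδ] at h2
      linarith
    have e5 : (N : ℝ) ≤ δ / 3 * L := by
      rw [div_lt_iff₀ hδ] at hc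
      have h1 : (L : ℝ) = N * (c + 1) + 1 := by rw [hLdef]; push_cast; ring
      have h2 : (0 : ℝ) ≤ N := by positivity
      rw [h1]
      nlinarith [mul_nonneg h2 (sub_nonneg.2 hc.le), mul_nonneg h2 hδ.le]
    have e6 : (n : ℝ) / L * N ≤ δ / 3 * n := by
      have h0 : (0 : ℝ) ≤ n / L := by positivity
      refine (mul_le_mul_of_nonneg_left e5 h0).trans (le_of_eq ?_)
      field_simp
    have e7 : ((n / L : ℕ) : ℝ) * N ≤ n / L * N :=
      mul_le_mul_of_nonneg_right e2 (by positivity)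
    nlinarith
  · intro w q M
    have hp : ∀ n : ℕ, ∃ p : X, n ∈ G → ∀ i < L, dist (x (i + n)) (T^[i] p) < ε := by
      intro n
      by_cases h : n ∈ G
      · obtain ⟨p, hp⟩ := h
        exact ⟨p, fun _ => hp⟩
      · exact ⟨w, fun h' => absurd h' h⟩
    choose p hp using hp
    let y : ℕ → X := fun j => Nat.casesOn j w (fun j => T^[N] (p ((q + j) * L)))
    let a : ℕ → ℕ := fun j => Nat.casesOn j 0 (fun j => (q + j) * L + N)
    let b : ℕ → ℕ := fun j => Nat.casesOn j (q * L) (fun j => (q + j) * L + (L - 1))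
    obtain ⟨z, hz⟩ := hS (M + 2) (by omega) y a b rfl
      (by
        intro j _
        cases j with
        | zero => exact Nat.zero_le _
        | succ j => show (q + j) * L + N ≤ (q + j) * L + (L - 1); omega)
      (by
        intro j _
        cases j with
        | zero => show q * L < (q + 0) * L + N; simp; omega
        | succ j =>
          show (q + j) * L + (L - 1) < (q + (j + 1)) * L + N
          have : (q + (j + 1)) * L = (q + j) * L + L := by ring
          omega)
      (by
        intro j _
        cases j with
        | zero => show N ≤ (q + 0) * L + N - q * L; simp
        | succ j =>
          show N ≤ (q + (j + 1)) * L + N - ((q + j) * L + (L - 1))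
          have : (q + (j + 1)) * L = (q + j) * L + L := by ring
          omega)
    refine ⟨z, ?_, ?_⟩
    · intro n hn
      have := hz 0 (by omega) n (Nat.zero_le _) (show n ≤ q * L by rw [mul_comm]; omega)
      simpa [y, a] using this
    · intro n hn hnM hnP
      simp only [Set.mem_union, Set.mem_ofPred_eq, Set.mem_compl_iff, not_or, not_lt,
        not_not] at hnP
      obtain ⟨h1, h2⟩ := hnP
      have hq : q ≤ n / L := (Nat.le_div_iff_mul_le hL).2 (by rw [mul_comm]; exact hn)
      have hdl : n / L ≤ n := Nat.div_le_self _ _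
      obtain ⟨j, hj⟩ := Nat.exists_eq_add_of_le hq
      have hmod := Nat.mod_lt n hL
      have hdm := Nat.div_add_mod' n L
      rw [hj] at hdm h2
      have h3 := hz (j + 1) (by omega) n (show (q + j) * L + N ≤ n by omega)
        (show n ≤ (q + j) * L + (L - 1) by omega)
      have h4 := hp _ h2 (n % L) hmod
      have h5 : n - a (j + 1) = n % L - N := by
        show n - ((q + j) * L + N) = _
        omega
      have h6 : T^[n - a (j + 1)] (y (j + 1)) = T^[n % L] (p ((q + j) * L)) := by
        rw [h5]
        show T^[n % L - N] (T^[N] (p ((q + j) * L))) = _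
        rw [← Function.iterate_add_apply, Nat.sub_add_cancel h1]
      rw [h6] at h3
      rw [show n % L + (q + j) * L = n by omega, dist_comm] at h4
      have := dist_triangle (T^[n] z) (T^[n % L] (p ((q + j) * L))) (x n)
      linarith

theorem vagueSpec_of_specProp {X : Type*} [MetricSpace X] [CompactSpace X]
    (hdiam : ∀ x y : X, dist x y ≤ 1)
    (T : X → X) (hT : Continuous T) (hspec : SpecProp T) :
    VagueSpec T := by
  intro x hx
  have hst := fun k : ℕ => step_lemma T hspec x hx ((1 / 2) ^ k) ((1 / 2) ^ k)
    (by positivity) (by positivity)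
  choose P L M0 hL hP step using hst
  choose F hF1 hF2 using step
  -- quotient sequence: m k = L k * q k
  let q : ℕ → ℕ := fun k =>
    Nat.rec 0 (fun k qk => M0 (k + 1) + 2 ^ (k + 1) * (L k * qk) + 1) k
  have hq : ∀ k, q (k + 1) = M0 (k + 1) + 2 ^ (k + 1) * (L k * q k) + 1 := fun k => rfl
  let m : ℕ → ℕ := fun k => L k * q k
  have hm0 : m 0 = 0 := by simp [m, q]
  have hm : ∀ k, M0 (k + 1) + 2 ^ (k + 1) * m k + 1 ≤ m (k + 1) := by
    intro k
    show _ ≤ L (k + 1) * q (k + 1)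
    rw [hq]
    exact Nat.le_mul_of_pos_left _ (hL _)
  have hmlt : ∀ k, m k < m (k + 1) := by
    intro k
    have h1 := hm k
    have h2 : m k ≤ 2 ^ (k + 1) * m k := Nat.le_mul_of_pos_left _ (by positivity)
    omega
  have hmono : StrictMono m := strictMono_nat_of_lt_succ hmlt
  let W : ℕ → X := fun k => Nat.rec (x 0) (fun k w => F k w (q k) (m (k + 1))) k
  have hW : ∀ k, W (k + 1) = F k (W k) (q k) (m (k + 1)) := fun k => rfl
  have hW1 : ∀ k, ∀ n < m k, dist (T^[n] (W (k + 1))) (T^[n] (W k)) < (1 / 2 : ℝ) ^ k := by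
    intro k n hn
    rw [hW]
    exact hF1 k _ _ _ n hn
  have hW2 : ∀ k n, m k ≤ n → n < m (k + 1) → n ∉ P k →
      dist (T^[n] (W (k + 1))) (x n) < 2 * (1 / 2 : ℝ) ^ k := by
    intro k n h1 h2 h3
    rw [hW]
    exact hF2 k _ _ _ n h1 h2 h3
  have hW3 : ∀ k n, n < m (k + 1) → ∀ i,
      dist (T^[n] (W (k + 1 + i))) (T^[n] (W (k + 1)))
        ≤ (1 / 2 : ℝ) ^ k - (1 / 2 : ℝ) ^ (k + i) := by
    intro k n hn i
    induction i with
    | zero => simp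
    | succ i ih =>
      have h1 := hW1 (k + 1 + i) n (hn.trans_le (hmono.monotone (by omega)))
      have h2 := dist_triangle (T^[n] (W (k + 1 + (i + 1)))) (T^[n] (W (k + 1 + i)))
        (T^[n] (W (k + 1)))
      have h3 : (1 / 2 : ℝ) ^ (k + 1 + i) = (1 / 2) ^ (k + i) / 2 := by ring
      have h4 : (1 / 2 : ℝ) ^ (k + (i + 1)) = (1 / 2) ^ (k + i) / 2 := by ring
      rw [show k + 1 + (i + 1) = k + 1 + i + 1 by ring] at h2 ⊢
      linarith
  obtain ⟨z, -, φ, hφ, hlim⟩ := isCompact_univ.tendsto_subseq (fun k => Set.mem_univ (W k))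
  have hz : ∀ k n, n < m (k + 1) → dist (T^[n] z) (T^[n] (W (k + 1))) ≤ (1 / 2 : ℝ) ^ k := by
    intro k n hn
    have hc : Tendsto (fun i => dist (T^[n] (W (φ i))) (T^[n] (W (k + 1)))) atTop
        (𝓝 (dist (T^[n] z) (T^[n] (W (k + 1))))) :=
      Tendsto.dist (((hT.iterate n).tendsto z).comp hlim) tendsto_const_nhds
    refine le_of_tendsto hc ?_
    filter_upwards [eventually_ge_atTop (k + 1)] with i hi
    obtain ⟨j, hj⟩ := Nat.exists_eq_add_of_le (hi.trans (hφ.id_le i))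
    rw [hj]
    have := hW3 k n hn j
    have : (0 : ℝ) < (1 / 2) ^ (k + j) := by positivity
    linarith
  have hzx : ∀ k n, m k ≤ n → n < m (k + 1) → n ∉ P k →
      dist (T^[n] z) (x n) < 3 * (1 / 2 : ℝ) ^ k := by
    intro k n h1 h2 h3
    have := hW2 k n h1 h2 h3
    have := hz k n h2
    have := dist_triangle (T^[n] z) (T^[n] (W (k + 1))) (x n)
    linarith
  refine ⟨z, fun ε hε => densityOne_of _ fun δ hδ => ?_⟩
  obtain ⟨K, hK⟩ := exists_pow_lt_of_lt_one (lt_min hδ (div_pos hε three_pos))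
    (show (1 / 2 : ℝ) < 1 by norm_num)
  have hK1 := hK.trans_le (min_le_left _ _)
  have hK2 := hK.trans_le (min_le_right _ _)
  refine ⟨m (K + 2), fun n hn => ?_⟩
  -- find k
  obtain ⟨k, hk1, hk2, hk3⟩ : ∃ k, K + 1 ≤ k ∧ m (k + 1) ≤ n ∧ n < m (k + 2) := by
    classical
    have hex : ∃ k, n < m k := ⟨n + 1, (Nat.lt_succ_self n).trans_le (hmono.id_le (n + 1))⟩
    have h1 := Nat.find_spec hex
    have h2 : K + 2 < Nat.find hex := by
      by_contra h
      have := hmono.monotone (not_lt.1 h)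
      omega
    refine ⟨Nat.find hex - 2, by omega, ?_, ?_⟩
    · exact not_lt.1 (Nat.find_min hex (by omega))
    · rwa [Nat.sub_add_cancel (by omega)]
  obtain ⟨k', rfl⟩ : ∃ k', k = k' + 1 := ⟨k - 1, by omega⟩
  set k := k' + 1 with hkdef
  have hpow : ∀ j, K ≤ j → (1 / 2 : ℝ) ^ j ≤ (1 / 2) ^ K := fun j hj =>
    pow_le_pow_of_le_one (by norm_num) (by norm_num) hj
  have hsub : cntBelow {n : ℕ | dist (T^[n] z) (x n) < ε}ᶜ n
      ≤ cntBelow ({i | i < m k} ∪ (P k ∪ P (k + 1))) n := by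
    apply cnt_mono
    intro i hi hbad
    simp only [Set.mem_compl_iff, Set.mem_ofPred_eq, not_lt] at hbad
    by_contra hcon
    simp only [Set.mem_union, Set.mem_ofPred_eq, not_or, not_lt] at hcon
    obtain ⟨g1, g2, g3⟩ := hcon
    by_cases hik : i < m (k + 1)
    · have := hzx k i g1 hik g2
      have := hpow k (by omega)
      linarith
    · have := hzx (k + 1) i (not_lt.1 hik) (hi.trans hk3) g3
      have := hpow (k + 1) (by omega)
      linarith
  have hcnt : (cntBelow {n : ℕ | dist (T^[n] z) (x n) < ε}ᶜ n : ℝ)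
      ≤ m k + (cntBelow (P k) n + cntBelow (P (k + 1)) n) := by
    exact_mod_cast hsub.trans ((cnt_union _ _ n).trans
      (add_le_add (cnt_lt _ _) (cnt_union _ _ n)))
  have hmk := hm k
  have hmk' : M0 k + 2 ^ k * m k' + 1 ≤ m k := hm k'
  have hlt := hmlt k
  have b1 := hP k n (by omega)
  have b2 := hP (k + 1) n (by omega)
  have b3 : (m k : ℝ) ≤ (1 / 2) ^ (k + 1) * n := by
    have h1 : (2 : ℝ) ^ (k + 1) * m k ≤ n := by
      exact_mod_cast (by omega : 2 ^ (k + 1) * m k ≤ n)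
    have h2 : (m k : ℝ) = (1 / 2) ^ (k + 1) * (2 ^ (k + 1) * m k) := by
      rw [← mul_assoc, ← mul_pow]; norm_num
    rw [h2]
    exact mul_le_mul_of_nonneg_left h1 (by positivity)
  have h5 : (1 / 2 : ℝ) ^ (k + 1) = (1 / 2) ^ k / 2 := by ring
  have h6 : (1 / 2 : ℝ) ^ k ≤ (1 / 2) ^ K / 2 := by
    have := pow_le_pow_of_le_one (show (0 : ℝ) ≤ 1 / 2 by norm_num) (by norm_num) hk1
    rw [pow_succ (1 / 2 : ℝ) K] at this
    linarith
  have hn0 : (0 : ℝ) ≤ n := by positivity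
  rw [h5] at b2 b3
  have h7 : (1 / 2 : ℝ) ^ k * n ≤ δ / 2 * n :=
    mul_le_mul_of_nonneg_right (by linarith) hn0
  linarith
end

section
/- If a topological dynamical system (X,T) has the weak specification property, then (X,T) has the vague specification property. -/
open Filter Topology

/-- The weak specification property. -/
def WeakSpecProp {X : Type*} [MetricSpace X] (T : X → X) : Prop :=
  ∀ ε : ℝ, 0 < ε → ∃ M : ℕ → ℕ,
    Tendsto (fun n : ℕ => (M n : ℝ) / n) atTop (𝓝 0) ∧
    ∀ k : ℕ, 0 < k → ∀ x : ℕ → X, ∀ a b : ℕ → ℕ,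
      a 0 = 0 →
      (∀ j : ℕ, j < k → a j ≤ b j) →
      (∀ j : ℕ, j + 1 < k → b j < a (j + 1)) →
      (∀ j : ℕ, j + 1 < k → M (b (j + 1) - a (j + 1) + 1) ≤ a (j + 1) - b j) →
      ∃ z : X, ∀ j : ℕ, j < k → ∀ n : ℕ, a j ≤ n → n ≤ b j →
        dist (T^[n] z) (T^[n - a j] (x j)) < ε

open Classical in
/-- Number of `i < n` outside `A`. -/
noncomputable def badCount (A : Set ℕ) (n : ℕ) : ℕ :=
  ((Finset.range n).filter (fun i => i ∉ A)).card

open Classical in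
lemma card_add_badCount (A : Set ℕ) (n : ℕ) :
    Nat.card {i : ℕ // i < n ∧ i ∈ A} + badCount A n = n := by
  have h1 : Nat.card {i : ℕ // i < n ∧ i ∈ A} =
      ((Finset.range n).filter (fun i => i ∈ A)).card := by
    apply Nat.subtype_card
    intro x
    simp
  rw [h1, badCount, Finset.card_filter_add_card_filter_not, Finset.card_range]

lemma density_eq (A : Set ℕ) (n : ℕ) (hn : 0 < n) :
    (Nat.card {i : ℕ // i < n ∧ i ∈ A} : ℝ) / n = 1 - (badCount A n : ℝ) / n := by
  have h := card_add_badCount A n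
  have h' : (Nat.card {i : ℕ // i < n ∧ i ∈ A} : ℝ) + (badCount A n : ℝ) = n := by
    exact_mod_cast h
  have hn' : (n : ℝ) ≠ 0 := by positivity
  field_simp
  linarith

lemma density_le_one (A : Set ℕ) (n : ℕ) :
    (Nat.card {i : ℕ // i < n ∧ i ∈ A} : ℝ) / n ≤ 1 := by
  apply div_le_one_of_le₀ _ (by positivity)
  have h := card_add_badCount A n
  exact_mod_cast (by omega : Nat.card {i : ℕ // i < n ∧ i ∈ A} ≤ n)

lemma densityOne_forward {A : Set ℕ} (h : DensityOne A) (ε : ℝ) (hε : 0 < ε) :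
    ∀ᶠ n : ℕ in atTop, (badCount A n : ℝ) ≤ ε * n := by
  have hb : IsBoundedUnder (· ≥ ·) atTop
      (fun n : ℕ => (Nat.card {i : ℕ // i < n ∧ i ∈ A} : ℝ) / n) :=
    isBoundedUnder_of ⟨0, fun n => by positivity⟩
  have h2 := eventually_lt_of_lt_liminf (f := atTop) (b := 1 - ε) (by
    rw [show atTop.liminf (fun n : ℕ => (Nat.card {i : ℕ // i < n ∧ i ∈ A} : ℝ) / n) = 1 from h]
    linarith) hb
  filter_upwards [h2, eventually_gt_atTop 0] with n h3 hn
  rw [density_eq A n hn] at h3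
  have hn' : (0 : ℝ) < n := by exact_mod_cast hn
  have h4 : (badCount A n : ℝ) / n < ε := by linarith
  rw [div_lt_iff₀ hn'] at h4
  exact h4.le

lemma densityOne_backward {A : Set ℕ}
    (h : ∀ ε : ℝ, 0 < ε → ∀ᶠ n : ℕ in atTop, (badCount A n : ℝ) ≤ ε * n) : DensityOne A := by
  apply Tendsto.liminf_eq
  rw [Metric.tendsto_nhds]
  intro ε hε
  filter_upwards [h (ε / 2) (by linarith), eventually_gt_atTop 0] with n h3 hn
  have hn' : (0 : ℝ) < n := by exact_mod_cast hn
  rw [density_eq A n hn, Real.dist_eq]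
  have h4 : (badCount A n : ℝ) / n ≤ ε / 2 := by
    rw [div_le_iff₀ hn']; exact h3
  have h5 : (0 : ℝ) ≤ (badCount A n : ℝ) / n := by positivity
  rw [abs_lt]
  constructor <;> linarith

/-- Counting the complement of the periodic good set. -/
lemma badCount_grid (G : Set ℕ) (P m : ℕ) (hP : 0 < P) (n : ℕ) :
    badCount {i | m ≤ i % P ∧ i / P * P + m ∈ G} n ≤
      m * (n / P + 1) + P * badCount G (n + m) := by
  classical
  have hsub : (Finset.range n).filter (fun i => i ∉ {i | m ≤ i % P ∧ i / P * P + m ∈ G}) ⊆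
      (Finset.range n).filter (fun i => i % P < m) ∪
      (Finset.range n).filter (fun i => i / P * P + m ∉ G) := by
    intro i
    simp only [Finset.mem_filter, Finset.mem_union, Set.mem_ofPred_eq, not_and_or, not_le]
    tauto
  have h1 : ((Finset.range n).filter (fun i => i % P < m)).card ≤ m * (n / P + 1) := by
    have := Finset.card_le_mul_card_image_of_maps_to
      (s := (Finset.range n).filter (fun i => i % P < m)) (t := Finset.range (n / P + 1))
      (f := fun i => i / P) (by
        intro i hi
        simp only [Finset.mem_filter, Finset.mem_range] at hi ⊢
        exact Nat.lt_succ_of_le (Nat.div_le_div_right hi.1.le)) m (by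
        intro q _
        have : ((Finset.range n).filter (fun i => i % P < m)).filter (fun i => i / P = q) ⊆
            (Finset.range m).image (fun r => P * q + r) := by
          intro i hi
          simp only [Finset.mem_filter, Finset.mem_range, Finset.mem_image] at hi ⊢
          refine ⟨i % P, hi.1.2, ?_⟩
          rw [← hi.2]
          exact Nat.div_add_mod i P
        exact (Finset.card_le_card this).trans (Finset.card_image_le.trans (by simp)))
    simpa using this
  have h2 : ((Finset.range n).filter (fun i => i / P * P + m ∉ G)).card ≤
      P * badCount G (n + m) := by
    unfold badCount
    apply Finset.card_le_mul_card_image_of_maps_to (f := fun i => i / P * P + m)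
    · intro i hi
      simp only [Finset.mem_filter, Finset.mem_range] at hi ⊢
      have := Nat.div_mul_le_self i P
      exact ⟨by omega, hi.2⟩
    · intro s _
      have : ((Finset.range n).filter (fun i => i / P * P + m ∉ G)).filter
          (fun i => i / P * P + m = s) ⊆ (Finset.range P).image (fun r => s - m + r) := by
        intro i hi
        simp only [Finset.mem_filter, Finset.mem_range, Finset.mem_image] at hi ⊢
        refine ⟨i % P, Nat.mod_lt _ hP, ?_⟩
        rw [← hi.2]
        have := Nat.div_add_mod i P
        rw [mul_comm] at this
        omega
      exact (Finset.card_le_card this).trans (Finset.card_image_le.trans (by simp))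
  have h3 := ((Finset.card_le_card hsub).trans (Finset.card_union_le _ _)).trans
    (add_le_add h1 h2)
  refine le_trans (le_of_eq ?_) h3
  unfold badCount
  congr

lemma traceSet_density {X : Type*} [MetricSpace X] (T : X → X) (x : ℕ → X)
    (hx : IsVaguePO T x) (L : ℕ) (δ : ℝ) (hδ : 0 < δ) :
    DensityOne {n : ℕ | ∃ p, ∀ k, k < L → dist (x (k + n)) (T^[k] p) < δ} := by
  apply hx {y | ∃ p, ∀ k, k < L → dist (y k) (T^[k] p) < δ}
  · have : {y : ℕ → X | ∃ p, ∀ k, k < L → dist (y k) (T^[k] p) < δ} =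
      ⋃ p, ⋂ k ∈ Finset.range L, {y : ℕ → X | dist (y k) (T^[k] p) < δ} := by
      ext y; simp
    rw [this]
    refine isOpen_iUnion fun p => isOpen_biInter_finset fun k _ => ?_
    exact isOpen_lt (by fun_prop) continuous_const
  · rintro y ⟨p, rfl⟩
    exact ⟨p, fun k _ => by simpa using hδ⟩

/-- One stage of the construction. -/
lemma stage {X : Type*} [MetricSpace X] (T : X → X) (hspec : WeakSpecProp T) (x : ℕ → X)
    (hx : IsVaguePO T x) (ε : ℝ) (hε : 0 < ε) :
    ∃ (P : ℕ) (D : Set ℕ), 0 < P ∧ (∀ᶠ n : ℕ in atTop, (badCount D n : ℝ) ≤ ε * n) ∧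
      ∀ N N' : ℕ, P ∣ N → ∀ w : X, ∃ z : X,
        (∀ n, n ≤ N → dist (T^[n] z) (T^[n] w) < ε) ∧
        ∀ n, n ∈ D → N ≤ n → n < N' → dist (T^[n] z) (x n) < ε := by
  classical
  obtain ⟨M, hM, hS⟩ := hspec (ε / 2) (by linarith)
  have hM2 : Tendsto (fun n : ℕ => (M n : ℝ) / n + 1 / n) atTop (𝓝 0) := by
    simpa using hM.add (tendsto_one_div_atTop_nhds_zero_nat (𝕜 := ℝ))
  obtain ⟨L, hL, hL0⟩ := ((hM2.eventually_lt_const (by linarith : (0 : ℝ) < ε / 4)).and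
    (eventually_gt_atTop 0)).exists
  obtain ⟨l, rfl⟩ : ∃ l, L = l + 1 := ⟨L - 1, by omega⟩
  obtain ⟨m, hm⟩ : ∃ m, m = M (l + 1) + 1 := ⟨_, rfl⟩
  obtain ⟨P, hPdef⟩ : ∃ P, P = m + l + 1 := ⟨_, rfl⟩
  have hP : 0 < P := by omega
  have hP' : (0 : ℝ) < P := by exact_mod_cast hP
  have hmP : (m : ℝ) ≤ ε / 4 * P := by
    have h1 : ((l + 1 : ℕ) : ℝ) > 0 := by positivity
    rw [← add_div, div_lt_iff₀ h1] at hL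
    have h2 : ((l + 1 : ℕ) : ℝ) ≤ P := by exact_mod_cast (by omega : l + 1 ≤ P)
    have h3 : (m : ℝ) = M (l + 1) + 1 := by rw [hm]; push_cast; rfl
    nlinarith
  let G : Set ℕ := {n : ℕ | ∃ p, ∀ k, k < l + 1 → dist (x (k + n)) (T^[k] p) < ε / 2}
  have hG : DensityOne G := traceSet_density T x hx (l + 1) (ε / 2) (by linarith)
  refine ⟨P, {i | m ≤ i % P ∧ i / P * P + m ∈ G}, hP, ?_, ?_⟩
  · have h1 := densityOne_forward hG (ε / (4 * P)) (by positivity)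
    have h2 := (tendsto_add_atTop_nat m).eventually h1
    obtain ⟨N0, hN0⟩ := exists_nat_ge ((m + ε / 4 * m) / (ε / 2))
    filter_upwards [h2, eventually_ge_atTop N0] with n hn hnN
    have h3 : (badCount {i | m ≤ i % P ∧ i / P * P + m ∈ G} n : ℝ) ≤
      m * ((n / P : ℕ) + 1) + P * badCount G (n + m) := by
      exact_mod_cast badCount_grid G P m hP n
    have h4 : ((n / P : ℕ) : ℝ) ≤ n / P := Nat.cast_div_le
    have h5 : (m : ℝ) * (n / P : ℕ) ≤ ε / 4 * n := by
      calc (m : ℝ) * (n / P : ℕ) ≤ (ε / 4 * P) * (n / P) := by gcongr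
        _ = ε / 4 * n := by field_simp
    have h6 : (P : ℝ) * badCount G (n + m) ≤ ε / 4 * (n + m) := by
      calc (P : ℝ) * badCount G (n + m) ≤ P * (ε / (4 * P) * ((n + m : ℕ) : ℝ)) := by gcongr
        _ = ε / 4 * (n + m) := by push_cast; field_simp
    have h7 : (N0 : ℝ) ≤ n := by exact_mod_cast hnN
    have h8 := hN0.trans h7
    rw [div_le_iff₀ (by linarith)] at h8
    nlinarith
  · intro N N' hPN w
    let g : ℕ → X := fun s => if h : s ∈ G then Classical.choose h else w
    have hg : ∀ s, s ∈ G → ∀ k, k < l + 1 → dist (x (k + s)) (T^[k] (g s)) < ε / 2 := by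
      intro s hs
      have : g s = Classical.choose hs := dif_pos hs
      rw [this]
      exact Classical.choose_spec hs
    let a : ℕ → ℕ := fun j => Nat.casesOn j 0 (fun j => N + j * P + m)
    let b : ℕ → ℕ := fun j => Nat.casesOn j N (fun j => N + j * P + m + l)
    let y : ℕ → X := fun j => Nat.casesOn j w (fun j => g (N + j * P + m))
    have ha0 : a 0 = 0 := rfl
    have hb0 : b 0 = N := rfl
    have has : ∀ j, a (j + 1) = N + j * P + m := fun _ => rfl
    have hbs : ∀ j, b (j + 1) = N + j * P + m + l := fun _ => rfl
    have hys : ∀ j, y (j + 1) = g (N + j * P + m) := fun _ => rfl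
    have hgap : ∀ j, b j + m ≤ a (j + 1) := by
      intro j
      cases j with
      | zero => rw [hb0, has]; omega
      | succ j =>
        rw [hbs, has, Nat.succ_mul]; omega
    obtain ⟨z, hz⟩ := hS (N' + 2) (by omega) y a b ha0
      (by
        intro j _
        cases j with
        | zero => rw [ha0]; omega
        | succ j => rw [has, hbs]; omega)
      (by intro j _; have := hgap j; omega)
      (by
        intro j _
        have h1 := hgap j
        have h2 : b (j + 1) - a (j + 1) + 1 = l + 1 := by rw [has, hbs]; omega
        rw [h2]; omega)
    refine ⟨z, ?_, ?_⟩
    · intro n hn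
      have := hz 0 (by omega) n (Nat.zero_le _) hn
      rw [ha0, Nat.sub_zero] at this
      exact lt_trans this (by linarith)
    · rintro n ⟨hn1, hn2⟩ hNn hnN'
      obtain ⟨q, rfl⟩ := hPN
      have hq : q ≤ n / P := by
        rw [Nat.le_div_iff_mul_le hP, mul_comm]; exact hNn
      obtain ⟨j, hj⟩ := Nat.exists_eq_add_of_le hq
      have hs : P * q + j * P + m = n / P * P + m := by rw [hj]; ring
      have hdm := Nat.div_add_mod n P
      have hml := Nat.mod_lt n hP
      rw [mul_comm] at hdm
      have hjn : j ≤ n := by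
        have := Nat.div_le_self n P
        omega
      have h1 := hz (j + 1) (by omega) n (by rw [has, hs]; omega) (by rw [hbs, hs]; omega)
      rw [has, hys, hs] at h1
      have h2 := hg _ hn2 (n - (n / P * P + m)) (by omega)
      rw [Nat.sub_add_cancel (by omega)] at h2
      have h3 := dist_triangle_right (T^[n] z) (x n) (T^[n - (n / P * P + m)] (g (n / P * P + m)))
      linarith

lemma badCount_step (A D : Set ℕ) (N n : ℕ) 
    (h : ∀ i, N ≤ i → i < n → i ∈ D → i ∈ A) :
    badCount A n ≤ badCount A N + badCount D n := by
  classical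
  unfold badCount
  refine le_trans (Finset.card_le_card ?_) (Finset.card_union_le _ _)
  intro i
  simp only [Finset.mem_filter, Finset.mem_union, Finset.mem_range]
  rintro ⟨h1, h2⟩
  by_cases h3 : i < N
  · exact Or.inl ⟨h3, h2⟩
  · exact Or.inr ⟨h1, fun h4 => h2 (h i (by omega) h1 h4)⟩

lemma badCount_le (A : Set ℕ) (n : ℕ) : badCount A n ≤ n := by
  have := card_add_badCount A n
  omega

lemma badCount_glue (A : Set ℕ) (D : ℕ → Set ℕ) (N : ℕ → ℕ) (hN : StrictMono N)
    (hD : ∀ k n, N k ≤ n → (badCount (D k) n : ℝ) ≤ (1 / 2 : ℝ) ^ k * n) (K : ℕ)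
    (hA : ∀ k, K ≤ k → ∀ i, N k ≤ i → i < N (k + 1) → i ∈ D k → i ∈ A) (n : ℕ) :
    (badCount A n : ℝ) ≤ N K + 2 * (1 / 2 : ℝ) ^ K * n := by
  have claim : ∀ t, ∀ n, n ≤ N (K + t) →
      (badCount A n : ℝ) ≤ N K + (2 * (1 / 2 : ℝ) ^ K - 2 * (1 / 2 : ℝ) ^ (K + t)) * n := by
    intro t
    induction t with
    | zero =>
      intro n hn
      have h1 : (badCount A n : ℝ) ≤ N K := by exact_mod_cast (badCount_le A n).trans hn
      simpa using h1
    | succ t ih =>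
      intro n hn
      have e : (1 / 2 : ℝ) ^ (K + (t + 1)) = (1 / 2 : ℝ) ^ (K + t) / 2 := by
        rw [← add_assoc, pow_succ]; ring
      have hp : (0 : ℝ) < (1 / 2 : ℝ) ^ (K + t) := by positivity
      rw [e]
      rcases le_total n (N (K + t)) with h | h
      · have := ih n h
        have hn0 : (0 : ℝ) ≤ n := by positivity
        nlinarith
      · have h1 := ih _ le_rfl
        have h2 := hD (K + t) n h
        have h3 : (badCount A n : ℝ) ≤ badCount A (N (K + t)) + badCount (D (K + t)) n := by
          exact_mod_cast badCount_step A (D (K + t)) (N (K + t)) n (fun i hi hin hiD =>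
            hA (K + t) (by omega) i hi (lt_of_lt_of_le hin hn) hiD)
        have h4 : (N (K + t) : ℝ) ≤ n := by exact_mod_cast h
        have h5 : (1 / 2 : ℝ) ^ (K + t) ≤ (1 / 2 : ℝ) ^ K :=
          pow_le_pow_of_le_one (by norm_num) (by norm_num) (by omega)
        nlinarith [mul_nonneg (sub_nonneg.2 h5) (sub_nonneg.2 h4)]
  have h := claim n n ((hN.id_le n).trans (hN.monotone (by omega)))
  have hp : (0 : ℝ) < (1 / 2 : ℝ) ^ (K + n) := by positivity
  have hn0 : (0 : ℝ) ≤ n := by positivity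
  nlinarith

theorem vagueSpec_of_weakSpecProp {X : Type*} [MetricSpace X] [CompactSpace X]
    (hdiam : ∀ x y : X, dist x y ≤ 1)
    (T : X → X) (hT : Continuous T) (hspec : WeakSpecProp T) :
    VagueSpec T := by
  intro x hx
  choose P D hP hD hstep using fun k : ℕ =>
    stage T hspec x hx ((1 / 2 : ℝ) ^ k) (by positivity)
  obtain ⟨N, hN, hNP⟩ := extraction_forall_of_frequently
    (P := fun k n => P k ∣ n ∧ ∀ n', n ≤ n' → (badCount (D k) n' : ℝ) ≤ (1 / 2 : ℝ) ^ k * n') (by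
      intro k
      obtain ⟨N0, hN0⟩ := eventually_atTop.1 (hD k)
      rw [frequently_atTop]
      intro c
      have hle : c + N0 ≤ P k * (c + N0) := Nat.le_mul_of_pos_left _ (hP k)
      exact ⟨P k * (c + N0), by omega, dvd_mul_right _ _, fun n' hn' => hN0 n' (by omega)⟩)
  choose F hF1 hF2 using fun k w => hstep k (N k) (N (k + 1)) (hNP k).1 w
  let u : ℕ → X := fun k => Nat.rec (x 0) (fun k w => F k w) k
  have hu : ∀ k, u (k + 1) = F k (u k) := fun _ => rfl
  have hu1 : ∀ k n, n ≤ N k → dist (T^[n] (u k)) (T^[n] (u (k + 1))) ≤ (1 / 2 : ℝ) ^ k := by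
    intro k n hn
    rw [hu, dist_comm]
    exact (hF1 k (u k) n hn).le
  have hcau : CauchySeq u := by
    apply cauchySeq_of_le_geometric (1 / 2 : ℝ) 1 (by norm_num)
    intro k
    simpa using hu1 k 0 (Nat.zero_le _)
  obtain ⟨z, hz⟩ := cauchySeq_tendsto_of_complete hcau
  have hclose : ∀ k n, n ≤ N (k + 1) → dist (T^[n] (u (k + 1))) (T^[n] z) ≤ (1 / 2 : ℝ) ^ k := by
    intro k n hn
    have ht : Tendsto (fun j => T^[n] (u (j + (k + 1)))) atTop (𝓝 (T^[n] z)) :=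
      ((hT.iterate n).tendsto z).comp (hz.comp (tendsto_add_atTop_nat (k + 1)))
    have := dist_le_of_le_geometric_of_tendsto₀ (1 / 2 : ℝ) ((1 / 2 : ℝ) ^ (k + 1))
      (by norm_num) (f := fun j => T^[n] (u (j + (k + 1)))) (by
        intro j
        have h1 := hu1 (j + (k + 1)) n (hn.trans (hN.monotone (by omega)))
        rw [pow_add, mul_comm] at h1
        have e : j + 1 + (k + 1) = j + (k + 1) + 1 := by ring
        simp only [e]
        exact h1) ht
    simp only [zero_add] at this
    refine this.trans (le_of_eq ?_)
    rw [pow_succ]; ring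
  refine ⟨z, fun ε hε => densityOne_backward fun η hη => ?_⟩
  obtain ⟨K, hK⟩ := exists_pow_lt_of_lt_one (show (0 : ℝ) < min (ε / 2) (η / 4) by positivity)
    (show (1 / 2 : ℝ) < 1 by norm_num)
  have hK1 := lt_of_lt_of_le hK (min_le_left _ _)
  have hK2 := lt_of_lt_of_le hK (min_le_right _ _)
  have hglue := badCount_glue {n : ℕ | dist (T^[n] z) (x n) < ε} D N hN
    (fun k n h => (hNP k).2 n h) K (by
      intro k hk i hi1 hi2 hiD
      have h1 := hF2 k (u k) i hiD hi1 hi2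
      rw [← hu] at h1
      have h2 := hclose k i hi2.le
      have h3 := dist_triangle_left (T^[i] z) (x i) (T^[i] (u (k + 1)))
      have h5 : (1 / 2 : ℝ) ^ k ≤ (1 / 2 : ℝ) ^ K :=
        pow_le_pow_of_le_one (by norm_num) (by norm_num) hk
      show dist (T^[i] z) (x i) < ε
      linarith)
  obtain ⟨N0, hN0⟩ := exists_nat_ge ((N K : ℝ) / (η / 2))
  filter_upwards [eventually_ge_atTop N0] with n hn
  have h1 := hglue n
  have h7 : (N0 : ℝ) ≤ n := by exact_mod_cast hn
  have h8 := hN0.trans h7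
  rw [div_le_iff₀ (by linarith)] at h8
  have hn0 : (0 : ℝ) ≤ n := by positivity
  nlinarith
end
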